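/- Let H_1 be a 1×n parity-check matrix over F_3 with support I_1, and let F = (f_i^(α)) be a 2×n nonnegative integer matrix with F ∈ K_3(H_1) satisfying, with H_1 regarded as an integer matrix with entries in {0,1,2}, H_1·(F_1^T + 2·F_2^T) ≡ 0 (mod 3), where F_1, F_2 are the rows of F. Suppose the pair of distinct coordinates {k,ℓ} ⊆ I_1 is critical of type two, i.e., f_k^(2H_{1,k}) ≥ 1, f_ℓ^(2H_{1,ℓ}) ≥ 1, and 2·Σ_{i∈I_1\{k,ℓ}} f_i^(2H_{1,i}) + Σ_{i∈I_1} f_i^(H_{1,i}) < f_k^(2H_{1,k}) + f_ℓ^(2H_{1,ℓ}) + 3. Then the corresponding cone inequality holds with equality: 2·Σ_{i∈I_1\{k,ℓ}} f_i^(2H_{1,i}) + Σ_{i∈I_1} f_i^(H_{1,i}) = f_k^(2H_{1,k}) + f_ℓ^(2H_{1,ℓ}). -/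

import Mathlib

open Finset

/-- Entry `f_i^(α)` of a 2×n matrix `F` whose rows are indexed by the nonzero
elements `1, 2` of `F_3` (row `0` of `F` is the row for `α = 1`,
row `1` of `F` is the row for `α = 2`). Only used with `α ≠ 0`. -/
def entryR {n : ℕ} (F : Matrix (Fin 2) (Fin n) ℝ) (α : ZMod 3) (i : Fin n) : ℝ :=
  if α = 1 then F 0 i else F 1 i

/-- The support `I_j` of the `j`-th row of `H`. -/
def suppRow {m n : ℕ} (H : Matrix (Fin m) (Fin n) (ZMod 3)) (j : Fin m) : Finset (Fin n) :=
  Finset.univ.filter fun i => H j i ≠ 0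

/-- The ternary fundamental cone `K_3(H)`. -/
def ternaryCone {m n : ℕ} (H : Matrix (Fin m) (Fin n) (ZMod 3)) :
    Set (Matrix (Fin 2) (Fin n) ℝ) :=
  { F |
    (∀ j : Fin m, ∀ ℓ ∈ suppRow H j,
      2 * entryR F (H j ℓ) ℓ + entryR F (2 * H j ℓ) ℓ ≤
        2 * ∑ i ∈ (suppRow H j).erase ℓ, entryR F (2 * H j i) i
          + ∑ i ∈ (suppRow H j).erase ℓ, entryR F (H j i) i) ∧
    (∀ j : Fin m, ∀ ℓ ∈ suppRow H j,
      2 * entryR F (2 * H j ℓ) ℓ + entryR F (H j ℓ) ℓ ≤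
        2 * ∑ i ∈ (suppRow H j).erase ℓ, entryR F (H j i) i
          + ∑ i ∈ (suppRow H j).erase ℓ, entryR F (2 * H j i) i) ∧
    (∀ j : Fin m, ∀ k ∈ suppRow H j, ∀ ℓ ∈ suppRow H j, k ≠ ℓ →
      entryR F (H j k) k + entryR F (H j ℓ) ℓ ≤
        2 * ∑ i ∈ ((suppRow H j).erase k).erase ℓ, entryR F (H j i) i
          + ∑ i ∈ suppRow H j, entryR F (2 * H j i) i) ∧
    (∀ j : Fin m, ∀ k ∈ suppRow H j, ∀ ℓ ∈ suppRow H j, k ≠ ℓ →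
      entryR F (2 * H j k) k + entryR F (2 * H j ℓ) ℓ ≤
        2 * ∑ i ∈ ((suppRow H j).erase k).erase ℓ, entryR F (2 * H j i) i
          + ∑ i ∈ suppRow H j, entryR F (H j i) i) ∧
    (∀ α i, 0 ≤ F α i) }

/-- `H·(F_1^T + 2 F_2^T) ≡ 0 (mod 3)` componentwise, `H` regarded as an
integer matrix with entries in `{0,1,2}`. -/
def mod3Cond {m n : ℕ} (H : Matrix (Fin m) (Fin n) (ZMod 3))
    (F : Matrix (Fin 2) (Fin n) ℕ) : Prop :=
  ∀ j : Fin m, (∑ i, ((H j i).val : ℤ) * ((F 0 i : ℤ) + 2 * (F 1 i : ℤ))) % 3 = 0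

/-- `F` is realizable over the single parity-check code `C_j` determined by the
row `Hj`: its entries count occurrences of the symbols `1` and `2` in the
coordinates of a list of `M` codewords. -/
def Realizable3 {n : ℕ} (Hj : Fin n → ZMod 3) (F : Matrix (Fin 2) (Fin n) ℕ) : Prop :=
  ∃ (M : ℕ) (c : Fin M → Fin n → ZMod 3),
    (∀ μ, ∑ i, c μ i * Hj i = 0) ∧
    (∀ i, F 0 i = (Finset.univ.filter fun μ => c μ i = 1).card) ∧
    (∀ i, F 1 i = (Finset.univ.filter fun μ => c μ i = 2).card)

/-- Integer version of `entryR`. -/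
def entryZ {n : ℕ} (F : Matrix (Fin 2) (Fin n) ℕ) (α : ZMod 3) (i : Fin n) : ℤ :=
  if α = 1 then F 0 i else F 1 i

theorem entryR_map_natCast {n : ℕ} (F : Matrix (Fin 2) (Fin n) ℕ) (α : ZMod 3) (i : Fin n) :
    entryR (F.map (fun x => (x : ℝ))) α i = (entryZ F α i : ℝ) := by
  unfold entryR entryZ
  split_ifs <;> simp

/-- Each summand of the syndrome is congruent mod 3 to its expression in normalized entries. -/
theorem three_dvd_val_mul_sub_entryZ {n : ℕ} (F : Matrix (Fin 2) (Fin n) ℕ) (h : ZMod 3)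
    (hh : h ≠ 0) (i : Fin n) :
    (3 : ℤ) ∣ (h.val : ℤ) * ((F 0 i : ℤ) + 2 * (F 1 i : ℤ))
      - (entryZ F h i + 2 * entryZ F (2 * h) i) := by
  have h12 : h = 1 ∨ h = 2 := by
    revert hh
    revert h
    decide
  rcases h12 with rfl | rfl
  · have h1 : (1 : ZMod 3).val = 1 := rfl
    have h2 : (2 * 1 : ZMod 3) ≠ 1 := by decide
    simp only [entryZ, h1, if_neg h2, if_true]
    omega
  · have h1 : (2 : ZMod 3).val = 2 := rfl
    have h2 : (2 * 2 : ZMod 3) = 1 := by decide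
    have h3 : (2 : ZMod 3) ≠ 1 := by decide
    simp only [entryZ, h1, if_neg h3, if_pos h2]
    omega

/-- The parity condition in normalized entries, summed over the support. -/
theorem three_dvd_sum_entryZ {m n : ℕ} (H : Matrix (Fin m) (Fin n) (ZMod 3))
    (F : Matrix (Fin 2) (Fin n) ℕ) (hmod : mod3Cond H F) (j : Fin m) :
    (3 : ℤ) ∣ ∑ i ∈ suppRow H j, (entryZ F (H j i) i + 2 * entryZ F (2 * H j i) i) := by
  have hsum : ∑ i, ((H j i).val : ℤ) * ((F 0 i : ℤ) + 2 * (F 1 i : ℤ))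
      = ∑ i ∈ suppRow H j, ((H j i).val : ℤ) * ((F 0 i : ℤ) + 2 * (F 1 i : ℤ)) := by
    symm
    apply Finset.sum_subset (Finset.subset_univ _)
    intro i _ hi
    have h0 : H j i = 0 := by simpa [suppRow] using hi
    simp [h0]
  have hdvd := Int.dvd_of_emod_eq_zero (hmod j)
  rw [hsum] at hdvd
  refine (dvd_sub_right hdvd).mp ?_
  rw [← Finset.sum_sub_distrib]
  refine Finset.dvd_sum fun i hi => three_dvd_val_mul_sub_entryZ F _ ?_ i
  simpa [suppRow] using hi

/-- Lemma 8, case of a critical pair of coordinates of type two: for a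
nonnegative integer matrix `F ∈ K_3(H_1)` satisfying
`H_1·(F_1^T + 2 F_2^T) ≡ 0 (mod 3)`, a critical inequality of type two at a
pair of distinct coordinates `{k, ℓ} ⊆ I_1` holds with equality. -/
theorem critical_pair_type_two {n : ℕ} (H : Matrix (Fin 1) (Fin n) (ZMod 3))
    (F : Matrix (Fin 2) (Fin n) ℕ)
    (hcone : F.map (fun x => (x : ℝ)) ∈ ternaryCone H)
    (hmod : mod3Cond H F)
    (k ℓ : Fin n) (hk : k ∈ suppRow H 0) (hℓ : ℓ ∈ suppRow H 0) (hkl : k ≠ ℓ)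
    (hfk : 1 ≤ entryR (F.map (fun x => (x : ℝ))) (2 * H 0 k) k)
    (hfl : 1 ≤ entryR (F.map (fun x => (x : ℝ))) (2 * H 0 ℓ) ℓ)
    (hcrit :
      2 * ∑ i ∈ ((suppRow H 0).erase k).erase ℓ, entryR (F.map (fun x => (x : ℝ))) (2 * H 0 i) i
        + ∑ i ∈ suppRow H 0, entryR (F.map (fun x => (x : ℝ))) (H 0 i) i
      < entryR (F.map (fun x => (x : ℝ))) (2 * H 0 k) k
        + entryR (F.map (fun x => (x : ℝ))) (2 * H 0 ℓ) ℓ + 3) :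
    2 * ∑ i ∈ ((suppRow H 0).erase k).erase ℓ, entryR (F.map (fun x => (x : ℝ))) (2 * H 0 i) i
      + ∑ i ∈ suppRow H 0, entryR (F.map (fun x => (x : ℝ))) (H 0 i) i
    = entryR (F.map (fun x => (x : ℝ))) (2 * H 0 k) k
      + entryR (F.map (fun x => (x : ℝ))) (2 * H 0 ℓ) ℓ := by
  have hcone' := hcone.2.2.2.1 0 k hk ℓ hℓ hkl
  have hdvd := three_dvd_sum_entryZ H F hmod 0
  simp only [entryR_map_natCast] at hcone' hcrit ⊢
  rw [Finset.sum_add_distrib, ← Finset.mul_sum,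
    ← Finset.add_sum_erase _ (fun i => entryZ F (2 * H 0 i) i) hk,
    ← Finset.add_sum_erase _ (fun i => entryZ F (2 * H 0 i) i)
      (Finset.mem_erase.mpr ⟨hkl.symm, hℓ⟩)] at hdvd
  norm_cast at hcone' hcrit ⊢
  omega
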